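/- Let H be a subgroup of G. Then, as an identity of integers, ∑_{χ : G →* kˣ} (⟨W,1⟩_G − ⟨W,χ⟩_G) = #H · ∑_{χ : G →* kˣ, χ trivial on H} (⟨W,1⟩_G − ⟨W,χ⟩_G) + ∑_{ψ : H →* kˣ} (⟨W,1⟩_H − ⟨W,ψ⟩_H), where the first sum ranges over all characters χ : G →* kˣ, the second over those characters of G that are trivial on H, and the third over all characters ψ : H →* kˣ. -/

import Mathlib

open Module

/-- The `χ`-eigenspace of a representation `ρ` of `G` on `W`:
`W_χ = {w ∈ W | ρ(g) w = χ(g) • w for all g ∈ G}`.  Its dimension is the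
multiplicity `⟨W, χ⟩_G` of `χ` in `W`. -/
def Representation.charSpace {k G W : Type*} [Field k] [Monoid G]
    [AddCommGroup W] [Module k W]
    (ρ : Representation k G W) (χ : G →* kˣ) : Submodule k W where
  carrier := {w : W | ∀ g : G, ρ g w = (χ g : k) • w}
  add_mem' := by
    intro a b ha hb g
    simp [map_add, ha g, hb g, smul_add]
  zero_mem' := by
    intro g
    simp
  smul_mem' := by
    intro c w hw g
    simp only [map_smul, hw g]
    rw [smul_comm]


section helpers
variable {k : Type*} [Field k] [CharZero k] {G : Type*} [CommGroup G] [Fintype G]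
    {W : Type*} [AddCommGroup W] [Module k W] [FiniteDimensional k W]

theorem aux_trace (ρ : Representation k G W) (χ : G →* kˣ) :
    (Fintype.card G : k) * (finrank k (ρ.charSpace χ) : k)
      = ∑ g : G, ((χ g⁻¹ : kˣ) : k) * LinearMap.trace k W (ρ g) := by
  have hc : (Fintype.card G : k) ≠ 0 := by simp
  have hp : LinearMap.IsProj (ρ.charSpace χ)
      ((Fintype.card G : k)⁻¹ • ∑ g : G, ((χ g⁻¹ : kˣ) : k) • ρ g) := by
    constructor
    · intro x g
      simp only [LinearMap.smul_apply, LinearMap.sum_apply, map_smul, map_sum]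
      rw [smul_comm]
      congr 1
      rw [Finset.smul_sum]
      refine Fintype.sum_equiv (Equiv.mulLeft g) _ _ fun y => ?_
      have hg : (χ g : k) ≠ 0 := (χ g).ne_zero
      simp only [Equiv.coe_mulLeft, mul_inv_rev, map_mul, smul_smul, ← Module.End.mul_apply,
        map_inv, Units.val_mul, Units.val_inv_eq_inv_val]
      congr 1
      field_simp
    · intro x hx
      have hx' : ∀ g : G, ρ g x = (χ g : k) • x := hx
      simp [hx', smul_smul, ← Nat.cast_smul_eq_nsmul k]
  have := hp.trace
  rw [← this, map_smul, map_sum, smul_eq_mul, mul_inv_cancel_left₀ hc]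
  simp

theorem aux_sum [HasEnoughRootsOfUnity k (Monoid.exponent G)]
    (ρ : Representation k G W) (H : Subgroup G) :
    ∑ᶠ χ ∈ {χ : G →* kˣ | ∀ h ∈ H, χ h = 1}, (finrank k (ρ.charSpace χ) : ℤ)
      = finrank k (Representation.charSpace (MonoidHom.comp ρ H.subtype) 1) := by
  classical
  have hfin : Finite (G →* kˣ) := Nat.finite_of_card_ne_zero (by
    rw [CommGroup.card_monoidHom_of_hasEnoughRootsOfUnity]; exact Nat.card_pos.ne')
  let K : Subgroup (G →* kˣ) := (MonoidHom.domRestrictHom H kˣ).ker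
  have hK : ∀ χ, χ ∈ K ↔ ∀ h ∈ H, χ h = 1 := by
    intro χ; simp [K, MonoidHom.mem_ker]
  have hset : {χ : G →* kˣ | ∀ h ∈ H, χ h = 1} = (K : Set (G →* kˣ)) := by
    ext χ; simp [hK]
  have : Fintype K := Fintype.ofFinite K
  rw [hset, ← finsum_set_coe_eq_finsum_mem, finsum_eq_sum_of_fintype]
  have hcK : (Fintype.card K : k) * Fintype.card H = Fintype.card G := by
    rw [← Nat.card_eq_fintype_card, CommGroup.card_domRestrictHom_ker k H,
      ← Nat.card_eq_fintype_card, ← Nat.card_eq_fintype_card (α := G),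
      H.card_eq_card_quotient_mul_card_subgroup, Nat.cast_mul]
  have horth : ∀ g : G, ∑ χ : K, (((χ : G →* kˣ) g⁻¹ : kˣ) : k)
      = if g ∈ H then (Fintype.card K : k) else 0 := by
    intro g
    let f : K →* k := 
      { toFun := fun χ => (((χ : G →* kˣ) g⁻¹ : kˣ) : k)
        map_one' := by simp
        map_mul' := by intro a b; simp }
    have h1 := sum_hom_units f
    have h2 : f = 1 ↔ g ∈ H := by
      rw [← CommGroup.forall_monoidHom_apply_eq_one_iff k H g, DFunLike.ext_iff]
      simp [f, hK]
    simp only [h2] at h1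
    rw [Nat.cast_ite] at h1
    simpa [f] using h1
  have hG : (Fintype.card G : k) ≠ 0 := by simp
  have main : (Fintype.card G : k) * ∑ χ : K, (finrank k (ρ.charSpace χ) : k) =
      (Fintype.card G : k) *
        finrank k (Representation.charSpace (MonoidHom.comp ρ H.subtype) 1) := by
    rw [Finset.mul_sum]
    simp_rw [aux_trace]
    rw [Finset.sum_comm]
    simp_rw [← Finset.sum_mul, horth]
    have h3 := aux_trace (G := H) (MonoidHom.comp ρ H.subtype) 1
    rw [← hcK, mul_assoc, h3]
    simp only [ite_mul, zero_mul, Finset.sum_ite, Finset.sum_const_zero, add_zero,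
      ← Finset.mul_sum]
    congr 1
    refine (Finset.sum_subtype (p := fun x => x ∈ H) (F := (inferInstance : Fintype H)) _ (by simp) _).trans ?_
    simp
  have := mul_left_cancel₀ hG main
  exact_mod_cast this

theorem aux_all [HasEnoughRootsOfUnity k (Monoid.exponent G)]
    (ρ : Representation k G W) :
    ∑ᶠ χ : G →* kˣ, (finrank k (ρ.charSpace χ) : ℤ) = finrank k W := by
  have h := aux_sum ρ (⊥ : Subgroup G)
  have ht : Representation.charSpace (MonoidHom.comp ρ (⊥ : Subgroup G).subtype) 1 = ⊤ := by
    rw [eq_top_iff]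
    rintro x - ⟨g, hg⟩
    obtain rfl := Subgroup.mem_bot.1 hg
    simp
  rw [ht, finrank_top] at h
  simpa using h


theorem aux_diff {α : Type*} (s : Set α) (hs : s.Finite) (a : ℤ) (f : α → ℤ) :
    ∑ᶠ x ∈ s, (a - f x) = Nat.card s * a - ∑ᶠ x ∈ s, f x := by
  rw [finsum_mem_sub_distrib _ _ hs]
  congr 1
  rw [finsum_mem_eq_finite_toFinset_sum _ hs, Finset.sum_const, nsmul_eq_mul,
    ← Nat.card_eq_card_finite_toFinset hs]

theorem aux_all_diff [HasEnoughRootsOfUnity k (Monoid.exponent G)]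
    (ρ : Representation k G W) (a : ℤ) :
    ∑ᶠ χ : G →* kˣ, (a - (finrank k (ρ.charSpace χ) : ℤ)) = Nat.card G * a - finrank k W := by
  have hfin : Finite (G →* kˣ) := Nat.finite_of_card_ne_zero (by
    rw [CommGroup.card_monoidHom_of_hasEnoughRootsOfUnity]; exact Nat.card_pos.ne')
  rw [← finsum_mem_univ, aux_diff _ Set.finite_univ, finsum_mem_univ, aux_all,
    Nat.card_univ, CommGroup.card_monoidHom_of_hasEnoughRootsOfUnity]

end helpers

/-- For a subgroup `H ≤ G`,
`∑_{χ : G →* kˣ} (⟨W,1⟩_G − ⟨W,χ⟩_G)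
  = #H · ∑_{χ trivial on H} (⟨W,1⟩_G − ⟨W,χ⟩_G) + ∑_{ψ : H →* kˣ} (⟨W,1⟩_H − ⟨W,ψ⟩_H)`. -/
theorem sum_multiplicity_diff_eq_card_mul_add
    {k : Type*} [Field k] [CharZero k]
    {G : Type*} [CommGroup G] [Fintype G]
    {W : Type*} [AddCommGroup W] [Module k W] [FiniteDimensional k W]
    (hζ : ∃ ζ : k, IsPrimitiveRoot ζ (Monoid.exponent G))
    (ρ : Representation k G W) (H : Subgroup G) :
    (∑ᶠ χ : G →* kˣ,
        ((finrank k (ρ.charSpace 1) : ℤ) - (finrank k (ρ.charSpace χ) : ℤ)))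
      = (Nat.card H : ℤ) *
          (∑ᶠ χ ∈ {χ : G →* kˣ | ∀ h ∈ H, χ h = 1},
            ((finrank k (ρ.charSpace 1) : ℤ) - (finrank k (ρ.charSpace χ) : ℤ)))
        + ∑ᶠ ψ : ↥H →* kˣ,
            ((finrank k (Representation.charSpace (MonoidHom.comp ρ H.subtype) 1) : ℤ)
              - (finrank k (Representation.charSpace (MonoidHom.comp ρ H.subtype) ψ) : ℤ)) := by

  classical
  obtain ⟨ζ, hζ⟩ := hζ
  have : NeZero (Monoid.exponent G) := ⟨Monoid.exponent_ne_zero_of_finite⟩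
  have hM : HasEnoughRootsOfUnity k (Monoid.exponent G) := ⟨⟨ζ, hζ⟩, inferInstance⟩
  have : HasEnoughRootsOfUnity k (Monoid.exponent H) :=
    hM.of_dvd k <| Monoid.exponent_submonoid_dvd H.toSubmonoid
  have hfin : Finite (G →* kˣ) := Nat.finite_of_card_ne_zero (by
    rw [CommGroup.card_monoidHom_of_hasEnoughRootsOfUnity]; exact Nat.card_pos.ne')
  have hset : {χ : G →* kˣ | ∀ h ∈ H, χ h = 1} =
      ((MonoidHom.domRestrictHom H kˣ).ker : Set (G →* kˣ)) := by
    ext χ; simp [MonoidHom.mem_ker]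
  have hc : Nat.card {χ : G →* kˣ | ∀ h ∈ H, χ h = 1} = Nat.card (G ⧸ H) := by
    rw [hset]; exact CommGroup.card_domRestrictHom_ker k H
  rw [aux_all_diff ρ, aux_all_diff (G := H), aux_diff _ (Set.toFinite _), aux_sum, hc,
    H.card_eq_card_quotient_mul_card_subgroup]
  push_cast
  ring
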